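/- Let y > 1 be fixed. For every integer k, A_k(n) → 1 as n → ∞, where A_k(n) = √(a(n)/π) · ∫_{−1}^{1} exp(−2πkt/log y) · e^{ψ_n(t) − ψ_n(0)} dt. -/

import Mathlib

open Filter Topology MeasureTheory in
/-- Laplace's method on `[-1, 1]`: a family that looks like `exp (-a n * t ^ 2)` at scale
`1 / √(a n)` and has a Gaussian upper bound at this scale has normalized integrals tending to `1`. -/
theorem tendsto_sqrt_div_pi_mul_integral {a : ℕ → ℝ} {G : ℕ → ℝ → ℂ} {b C : ℝ}
    (ha : Tendsto a atTop atTop) (hb : 0 < b) (hC : 0 ≤ C) (hG : ∀ n, Measurable (G n))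
    (hbound : ∀ᶠ n in atTop, ∀ t : ℝ, |t| ≤ 1 → ‖G n t‖ ≤ C * Real.exp (-b * (a n * t ^ 2)))
    (hlim : ∀ s : ℝ, Tendsto (fun n => G n (s / √(a n))) atTop
      (𝓝 ((Real.exp (-1 * s ^ 2) : ℝ) : ℂ))) :
    Tendsto (fun n => ((√(a n / Real.pi) : ℝ) : ℂ) * ∫ t in (-1 : ℝ)..1, G n t) atTop (𝓝 1) := by
  set F : ℕ → ℝ → ℂ := fun n =>
    (Set.Ioc (-√(a n)) (√(a n))).indicator (fun s => G n (s / √(a n))) with hF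
  have hsqrt : Tendsto (fun n => √(a n)) atTop atTop := Real.tendsto_sqrt_atTop.comp ha
  have key : Tendsto (fun n => ∫ s, F n s) atTop
      (𝓝 (∫ s : ℝ, ((Real.exp (-1 * s ^ 2) : ℝ) : ℂ))) := by
    refine tendsto_integral_filter_of_dominated_convergence
      (fun s => C * Real.exp (-b * s ^ 2)) ?_ ?_ ?_ ?_
    · refine Eventually.of_forall fun n => ?_
      exact (((hG n).comp (measurable_id.div_const _)).indicator
        measurableSet_Ioc).aestronglyMeasurable
    · filter_upwards [hbound, ha.eventually_gt_atTop 0] with n hn han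
      refine Eventually.of_forall fun s => ?_
      by_cases hs : s ∈ Set.Ioc (-√(a n)) (√(a n))
      · have hpos : 0 < √(a n) := Real.sqrt_pos.2 han
        have h1 : |s / √(a n)| ≤ 1 := by
          rw [abs_div, abs_of_pos hpos, div_le_one hpos]
          exact abs_le.2 ⟨hs.1.le, hs.2⟩
        have h2 := hn _ h1
        rw [div_pow, Real.sq_sqrt han.le, mul_div_cancel₀ _ han.ne'] at h2
        simpa only [hF, Set.indicator_of_mem hs] using h2
      · simp only [hF, Set.indicator_of_notMem hs, norm_zero]
        positivity
    · exact (integrable_exp_neg_mul_sq hb).const_mul C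
    · refine Eventually.of_forall fun s => ?_
      refine (hlim s).congr' ?_
      filter_upwards [hsqrt.eventually_gt_atTop |s|] with n hn
      have hs : s ∈ Set.Ioc (-√(a n)) (√(a n)) := ⟨(abs_lt.1 hn).1, (abs_lt.1 hn).2.le⟩
      simp only [hF, Set.indicator_of_mem hs]
  have hπ : ((√Real.pi : ℝ) : ℂ) ≠ 0 := by
    exact_mod_cast (Real.sqrt_pos.2 Real.pi_pos).ne'
  rw [integral_complex_ofReal, integral_gaussian, div_one] at key
  have key' := key.div_const ((√Real.pi : ℝ) : ℂ)
  rw [div_self hπ] at key'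
  refine key'.congr' ?_
  filter_upwards [ha.eventually_gt_atTop 0] with n han
  have hpos : 0 < √(a n) := Real.sqrt_pos.2 han
  have h := intervalIntegral.integral_comp_div (a := -√(a n)) (b := √(a n)) (G n) hpos.ne'
  rw [neg_div, div_self hpos.ne'] at h
  simp only [hF]
  rw [integral_indicator measurableSet_Ioc, ← intervalIntegral.integral_of_le (by linarith), h,
    Real.sqrt_div' _ Real.pi_pos.le, Complex.real_smul, Complex.ofReal_div]
  ring

theorem log_norm_one_add_mul_exp_le {u t : ℝ} (hu0 : 0 ≤ u) (hu1 : u < 1) (ht : |t| ≤ Real.pi) :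
    Real.log ‖(1 + u * Complex.exp (Complex.I * t) : ℂ)‖ ≤
      Real.log (1 + u) - u / (1 + u) ^ 2 * (2 / Real.pi ^ 2 * t ^ 2) := by
  set z : ℂ := 1 + u * Complex.exp (Complex.I * t) with hz
  set x : ℝ := u / (1 + u) ^ 2 * (1 - Real.cos t) with hx
  have hu : 0 < 1 + u := by linarith
  have hexp : ‖(u * Complex.exp (Complex.I * t) : ℂ)‖ = u := by
    rw [norm_mul, mul_comm Complex.I, Complex.norm_exp_ofReal_mul_I, Complex.norm_real,
      Real.norm_of_nonneg hu0, mul_one]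
  have hzpos : 0 < ‖z‖ := by
    have := norm_sub_norm_le (1 : ℂ) (-(u * Complex.exp (Complex.I * t)))
    rw [norm_neg, hexp, norm_one, sub_neg_eq_add] at this
    exact lt_of_lt_of_le (by linarith) this
  have hsq : ‖z‖ ^ 2 = (1 + u) ^ 2 * (1 - 2 * x) := by
    have hre : z.re = 1 + u * Real.cos t := by
      simp [hz, mul_comm Complex.I, Complex.exp_ofReal_mul_I_re]
    have him : z.im = u * Real.sin t := by
      simp [hz, mul_comm Complex.I, Complex.exp_ofReal_mul_I_im]
    rw [Complex.sq_norm, Complex.normSq_apply, hre, him, hx]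
    field_simp
    linear_combination u ^ 2 * Real.sin_sq_add_cos_sq t
  have hle : ‖z‖ ≤ (1 + u) * Real.exp (-x) := by
    refine le_of_sq_le_sq ?_ (by positivity)
    rw [hsq, mul_pow, ← Real.exp_nat_mul]
    gcongr
    have := Real.add_one_le_exp (((2 : ℕ) : ℝ) * -x)
    push_cast at this ⊢
    linarith
  have hcos : 2 / Real.pi ^ 2 * t ^ 2 ≤ 1 - Real.cos t := by
    have := Real.cos_le_one_sub_mul_cos_sq ht
    linarith
  calc Real.log ‖z‖ ≤ Real.log ((1 + u) * Real.exp (-x)) := Real.log_le_log hzpos hle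
    _ = Real.log (1 + u) - x := by
        rw [Real.log_mul hu.ne' (Real.exp_ne_zero _), Real.log_exp]; ring
    _ ≤ _ := by
        rw [hx]; gcongr

theorem norm_exp_I_mul_sub_le {t : ℝ} (ht : |t| ≤ 1) :
    ‖Complex.exp (Complex.I * t) - 1 - Complex.I * t + (t : ℂ) ^ 2 / 2‖ ≤ |t| ^ 3 := by
  have hn : ‖Complex.I * (t : ℂ)‖ = |t| := by simp
  have h := Complex.exp_bound (x := Complex.I * t) (by rwa [hn]) (n := 3) (by norm_num)
  rw [hn] at h
  have hsum : ∑ m ∈ Finset.range 3, (Complex.I * (t : ℂ)) ^ m / (m.factorial : ℂ) =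
      1 + Complex.I * t - (t : ℂ) ^ 2 / 2 := by
    simp [Finset.sum_range_succ, mul_pow, Nat.factorial]
    ring
  rw [hsum] at h
  calc _ = ‖Complex.exp (Complex.I * t) - (1 + Complex.I * t - (t : ℂ) ^ 2 / 2)‖ := by
        congr 1; ring
    _ ≤ _ := h
    _ ≤ |t| ^ 3 * 1 := by
        gcongr
        norm_num [Nat.factorial]
    _ = _ := mul_one _

theorem norm_log_one_add_sub_le {z : ℂ} (hz : ‖z‖ ≤ 1 / 2) :
    ‖Complex.log (1 + z) - z‖ ≤ ‖z‖ ^ 2 := by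
  have h := Complex.norm_log_one_add_sub_self_le (z := z) (by linarith)
  have h2 : (1 - ‖z‖)⁻¹ ≤ 2 := by
    rw [inv_le_comm₀ (by linarith) (by norm_num)]
    linarith
  nlinarith [sq_nonneg ‖z‖, mul_le_mul_of_nonneg_left h2 (sq_nonneg ‖z‖)]

open Filter Topology in
/-- Convergence of the phase at the Gaussian scale. -/
theorem tendsto_phase {L : ℝ} {r u t : ℕ → ℝ} {s : ℝ}
    (hu0 : ∀ n, 0 < u n) (hu : Tendsto u atTop (𝓝 0)) (ht : Tendsto t atTop (𝓝 0))
    (hw : Tendsto (fun n => n * u n * t n ^ 2) atTop (𝓝 (2 * s ^ 2)))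
    (hr : Tendsto (fun n => n * u n - r n / L) atTop (𝓝 0))
    (hnu : Tendsto (fun n => n * u n ^ 2) atTop (𝓝 0)) :
    Tendsto (fun n => -((t n : ℂ) ^ 2 + 2 * Complex.I * r n * t n) / (2 * L) +
      n * (Complex.log (1 + u n * Complex.exp (Complex.I * t n)) - Complex.log (1 + u n)))
      atTop (𝓝 (-1 * (s : ℂ) ^ 2)) := by
  have hlog : ∀ x : ℕ → ℝ, Tendsto (fun n : ℕ => (n : ℂ) *
      (Complex.log (1 + u n * Complex.exp (Complex.I * x n)) -
        u n * Complex.exp (Complex.I * x n))) atTop (𝓝 0) := by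
    intro x
    refine squeeze_zero_norm' ?_ hnu
    filter_upwards [hu.eventually_lt_const (show (0 : ℝ) < 1 / 2 by norm_num)] with n hn
    have hexp : ‖(u n * Complex.exp (Complex.I * x n) : ℂ)‖ = u n := by
      rw [norm_mul, mul_comm Complex.I, Complex.norm_exp_ofReal_mul_I, Complex.norm_real,
        Real.norm_of_nonneg (hu0 n).le, mul_one]
    have h := norm_log_one_add_sub_le (z := u n * Complex.exp (Complex.I * x n))
      (by rw [hexp]; exact hn.le)
    rw [hexp] at h
    rw [norm_mul, Complex.norm_natCast]
    gcongr
  have hcube : Tendsto (fun n => ((n * u n : ℝ) : ℂ) *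
      (Complex.exp (Complex.I * t n) - 1 - Complex.I * t n + (t n : ℂ) ^ 2 / 2))
      atTop (𝓝 0) := by
    have h0 : Tendsto (fun n => n * u n * t n ^ 2 * |t n|) atTop (𝓝 0) := by
      simpa using hw.mul ht.abs
    refine squeeze_zero_norm' ?_ h0
    filter_upwards [ht.abs.eventually_lt_const (show |(0 : ℝ)| < 1 by norm_num)] with n hn
    have hpos : 0 ≤ n * u n := by have := hu0 n; positivity
    rw [norm_mul, Complex.norm_real, Real.norm_of_nonneg hpos]
    calc _ ≤ n * u n * |t n| ^ 3 := by
          gcongr; exact norm_exp_I_mul_sub_le hn.le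
      _ = _ := by rw [← sq_abs (t n)]; ring
  have hlin : Tendsto (fun n => Complex.I * ((t n * (n * u n - r n / L) : ℝ) : ℂ))
      atTop (𝓝 0) := by
    simpa using (((Complex.continuous_ofReal.tendsto _).comp (ht.mul hr)).const_mul Complex.I)
  have hquad : Tendsto (fun n => ((-(t n ^ 2 / (2 * L)) - n * u n * t n ^ 2 / 2 : ℝ) : ℂ))
      atTop (𝓝 (-1 * (s : ℂ) ^ 2)) := by
    have h := (((ht.pow 2).div_const (2 * L)).neg).sub (hw.div_const 2)
    have hval : -((0 : ℝ) ^ 2 / (2 * L)) - 2 * s ^ 2 / 2 = -1 * s ^ 2 := by ring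
    rw [hval] at h
    simpa [Function.comp_def] using (Complex.continuous_ofReal.tendsto _).comp h
  have h0 := hlog fun _ => 0
  simp only [Complex.ofReal_zero, mul_zero, Complex.exp_zero, mul_one] at h0
  have htot := (((hquad.add hcube).add hlin).add (hlog t)).sub h0
  simp only [add_zero, sub_zero] at htot
  refine htot.congr fun n => ?_
  push_cast
  rcases eq_or_ne L 0 with rfl | hL
  · simp; ring
  · have : (L : ℂ) ≠ 0 := by exact_mod_cast hL
    field_simp
    ring

open Filter Topology in
theorem tendsto_atTop_of_mul_exp_add_eq {c K : ℝ} (hc : 0 < c) (hK : 0 < K) {r : ℕ → ℝ}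
    (hr : ∀ n : ℕ, 0 < n → 0 < r n ∧ r n * (Real.exp (r n) + c) = n * K) :
    Tendsto r atTop atTop := by
  rw [tendsto_atTop]
  intro M
  have hn : Tendsto (fun n : ℕ => (n : ℝ) * K) atTop atTop :=
    tendsto_natCast_atTop_atTop.atTop_mul_const hK
  filter_upwards [hn.eventually_gt_atTop (M * (Real.exp M + c)), eventually_gt_atTop 0]
    with n h1 h0
  obtain ⟨hpos, heq⟩ := hr n h0
  by_contra! hlt
  have : r n * (Real.exp (r n) + c) ≤ M * (Real.exp M + c) := by
    have := hpos.trans hlt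
    gcongr
  linarith

/-- For each integer `k`, `A_k(n) → 1` as `n → ∞`, where
`A_k(n) = √(a(n)/π) ∫_{−1}^{1} exp(−2πkt/log y) e^{ψ_n(t) − ψ_n(0)} dt`. -/
theorem A_k_tendsto_one (y : ℝ) (hy : 1 < y) (r a : ℕ → ℝ) (ψ : ℕ → ℝ → ℂ) (A : ℤ → ℕ → ℂ)
    (hr : ∀ n : ℕ, 0 < n →
      0 < r n ∧ r n * (Real.exp (r n) + Real.sqrt y) = n * Real.sqrt y * Real.log y)
    (ha : ∀ n : ℕ, a n = 1 / (2 * Real.log y) +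
      n * Real.sqrt y * Real.exp (-(r n)) / (2 * (1 + Real.sqrt y * Real.exp (-(r n))) ^ 2))
    (hψ : ∀ (n : ℕ) (s : ℝ), ψ n s =
      -((s : ℂ) ^ 2 + 2 * Complex.I * (r n) * s - (r n : ℂ) ^ 2) / (2 * Real.log y) +
        n * Complex.log (1 + Real.sqrt y * Real.exp (-(r n)) * Complex.exp (Complex.I * s)))
    (hA : ∀ (k : ℤ) (n : ℕ), A k n =
      (Real.sqrt (a n / Real.pi) : ℝ) *
        ∫ t in (-1 : ℝ)..1,
          Complex.exp (-(2 * Real.pi * k * t) / Real.log y) * Complex.exp (ψ n t - ψ n 0)) :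
    ∀ k : ℤ, Filter.Tendsto (fun n : ℕ => A k n) Filter.atTop (nhds 1) := by
  intro k
  set L := Real.log y with hLdef
  have hL : 0 < L := Real.log_pos hy
  have hc : 0 < √y := Real.sqrt_pos.2 (by linarith)
  have hrtop : Filter.Tendsto r Filter.atTop Filter.atTop :=
    tendsto_atTop_of_mul_exp_add_eq hc (mul_pos hc hL) fun n hn =>
      ⟨(hr n hn).1, by rw [(hr n hn).2, mul_assoc]⟩
  set u : ℕ → ℝ := fun n => √y * Real.exp (-(r n)) with hu_def
  have hu0 : ∀ n, 0 < u n := fun n => mul_pos hc (Real.exp_pos _)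
  have hu : Filter.Tendsto u Filter.atTop (nhds 0) := by
    simpa using (Real.tendsto_exp_neg_atTop_nhds_zero.comp hrtop).const_mul √y
  have hru : Filter.Tendsto (fun n => r n * u n) Filter.atTop (nhds 0) := by
    have h := ((Real.tendsto_pow_mul_exp_neg_atTop_nhds_zero 1).comp hrtop).const_mul √y
    rw [mul_zero] at h
    refine h.congr fun n => ?_
    simp only [Function.comp_apply, pow_one, hu_def]
    ring
  have hsaddle : ∀ n : ℕ, 0 < n → n * u n = r n * (1 + u n) / L := by
    intro n hn
    have h := (hr n hn).2
    have he : Real.exp (r n) * Real.exp (-(r n)) = 1 := by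
      rw [← Real.exp_add, add_neg_cancel, Real.exp_zero]
    simp only [hu_def]
    rw [eq_div_iff hL.ne']
    linear_combination (-Real.exp (-(r n))) * h + r n * he
  have hnu : Filter.Tendsto (fun n : ℕ => n * u n ^ 2) Filter.atTop (nhds 0) := by
    have h := (hru.mul (hu.const_add 1)).div_const L
    rw [zero_mul, zero_div] at h
    refine h.congr' ?_
    filter_upwards [Filter.eventually_gt_atTop 0] with n hn
    linear_combination -u n * hsaddle n hn
  have hlin : Filter.Tendsto (fun n : ℕ => n * u n - r n / L) Filter.atTop (nhds 0) := by
    have h := hru.div_const L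
    rw [zero_div] at h
    refine h.congr' ?_
    filter_upwards [Filter.eventually_gt_atTop 0] with n hn
    rw [hsaddle n hn]
    ring
  have hwtop : Filter.Tendsto (fun n : ℕ => n * u n) Filter.atTop Filter.atTop := by
    have h := hlin.add_atTop (hrtop.atTop_div_const hL)
    simpa using h
  have ha' : ∀ n, a n = 1 / (2 * L) + n * u n / (2 * (1 + u n) ^ 2) := by
    intro n
    rw [ha n]
    simp only [hu_def]
    ring
  have hapos : ∀ n, 0 < a n := by
    intro n
    rw [ha' n]
    have := hu0 n
    positivity
  have hratio : Filter.Tendsto (fun n : ℕ => a n / (n * u n)) Filter.atTop (nhds (1 / 2)) := by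
    have h1 : Filter.Tendsto (fun n : ℕ => 1 / (2 * L) / (n * u n)) Filter.atTop (nhds 0) :=
      hwtop.const_div_atTop _
    have h2 : Filter.Tendsto (fun n : ℕ => 1 / (2 * (1 + u n) ^ 2)) Filter.atTop
        (nhds (1 / (2 * (1 + 0) ^ 2))) :=
      tendsto_const_nhds.div (((hu.const_add 1).pow 2).const_mul 2) (by norm_num)
    have h := h1.add h2
    norm_num only at h
    refine h.congr' ?_
    filter_upwards [hwtop.eventually_gt_atTop 0] with n hn
    rw [ha' n, add_div, div_right_comm ((n : ℝ) * u n), div_self hn.ne']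
  have hatop : Filter.Tendsto a Filter.atTop Filter.atTop := by
    refine (hratio.pos_mul_atTop (by norm_num) hwtop).congr' ?_
    filter_upwards [hwtop.eventually_gt_atTop 0] with n hn
    exact div_mul_cancel₀ _ hn.ne'
  have hψ' : ∀ n (t : ℝ), ψ n t - ψ n 0 =
      -((t : ℂ) ^ 2 + 2 * Complex.I * r n * t) / (2 * L) +
        n * (Complex.log (1 + u n * Complex.exp (Complex.I * t)) - Complex.log (1 + u n)) := by
    intro n t
    rw [hψ n t, hψ n 0]
    simp only [hu_def, Complex.ofReal_mul, Complex.ofReal_zero, mul_zero, Complex.exp_zero,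
      mul_one]
    ring
  have hre : ∀ n (t : ℝ), (ψ n t - ψ n 0).re = -t ^ 2 / (2 * L) +
      n * (Real.log ‖(1 + u n * Complex.exp (Complex.I * t) : ℂ)‖ - Real.log (1 + u n)) := by
    intro n t
    have h1 : (-((t : ℂ) ^ 2 + 2 * Complex.I * r n * t) / (2 * L) : ℂ) =
        ((-t ^ 2 / (2 * L) : ℝ) : ℂ) + ((-(r n * t) / L : ℝ) : ℂ) * Complex.I := by
      have : (L : ℂ) ≠ 0 := by exact_mod_cast hL.ne'
      push_cast
      field_simp
      ring
    have h2 : (1 + u n : ℂ) = ((1 + u n : ℝ) : ℂ) := by push_cast; rfl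
    rw [hψ' n t, h1, h2, ← Complex.ofReal_natCast, Complex.add_re, Complex.re_ofReal_mul,
      Complex.sub_re, Complex.log_re, Complex.log_ofReal_re, Complex.add_re, Complex.ofReal_re,
      Complex.re_ofReal_mul, Complex.I_re, mul_zero, add_zero]
  have hbound : ∀ᶠ n in Filter.atTop, ∀ t : ℝ, |t| ≤ 1 →
      ‖Complex.exp (-(2 * Real.pi * k * t) / L) * Complex.exp (ψ n t - ψ n 0)‖ ≤
        Real.exp (2 * Real.pi * |(k : ℝ)| / L) *
          Real.exp (-(4 / Real.pi ^ 2) * (a n * t ^ 2)) := by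
    filter_upwards [hu.eventually_lt_const one_pos] with n hn t ht
    have hπ := Real.pi_gt_three
    have h1 : (-(2 * Real.pi * k * t) / L : ℂ) = ((-(2 * Real.pi * k * t) / L : ℝ) : ℂ) := by
      push_cast; rfl
    rw [norm_mul, Complex.norm_exp, Complex.norm_exp, h1, Complex.ofReal_re, hre n t]
    gcongr
    · calc -(2 * Real.pi * k * t) ≤ |-(2 * Real.pi * k * t)| := le_abs_self _
        _ = 2 * Real.pi * |(k : ℝ)| * |t| := by
            rw [abs_neg, abs_mul, abs_mul, abs_of_pos (by positivity : 0 < 2 * Real.pi)]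
        _ ≤ 2 * Real.pi * |(k : ℝ)| * 1 := by gcongr
        _ = _ := mul_one _
    · have h := log_norm_one_add_mul_exp_le (hu0 n).le hn (ht.trans (by linarith))
      have hq : 4 / Real.pi ^ 2 ≤ 1 := by
        rw [div_le_one (by positivity)]; nlinarith
      have h2 := mul_le_mul_of_nonneg_left (sub_le_sub_right h (Real.log (1 + u n)))
        (Nat.cast_nonneg (α := ℝ) n)
      have h3 := mul_le_mul_of_nonneg_right hq (show 0 ≤ t ^ 2 / (2 * L) by positivity)
      rw [ha' n]
      calc _ ≤ -t ^ 2 / (2 * L) + _ := add_le_add_right h2 _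
        _ = -(1 * (t ^ 2 / (2 * L))) -
            4 / Real.pi ^ 2 * (n * u n / (2 * (1 + u n) ^ 2) * t ^ 2) := by
            have := hu0 n
            field_simp
            ring
        _ ≤ -(4 / Real.pi ^ 2 * (t ^ 2 / (2 * L))) -
            4 / Real.pi ^ 2 * (n * u n / (2 * (1 + u n) ^ 2) * t ^ 2) := by gcongr
        _ = _ := by ring
  have hmeas : ∀ n, Measurable fun t : ℝ =>
      Complex.exp (-(2 * Real.pi * k * t) / L) * Complex.exp (ψ n t - ψ n 0) := by
    intro n
    simp only [hψ']
    fun_prop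
  have hlim : ∀ s : ℝ, Filter.Tendsto (fun n =>
      Complex.exp (-(2 * Real.pi * k * ((s / √(a n) : ℝ) : ℂ)) / L) *
        Complex.exp (ψ n (s / √(a n)) - ψ n 0)) Filter.atTop
      (nhds ((Real.exp (-1 * s ^ 2) : ℝ) : ℂ)) := by
    intro s
    have ht : Filter.Tendsto (fun n => s / √(a n)) Filter.atTop (nhds 0) :=
      (Real.tendsto_sqrt_atTop.comp hatop).const_div_atTop s
    have hw : Filter.Tendsto (fun n : ℕ => n * u n * (s / √(a n)) ^ 2) Filter.atTop
        (nhds (2 * s ^ 2)) := by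
      have h := (hratio.inv₀ (by norm_num)).mul_const (s ^ 2)
      rw [one_div, inv_inv] at h
      refine h.congr fun n => ?_
      rw [div_pow, Real.sq_sqrt (hapos n).le, inv_div]
      ring
    have hphase := tendsto_phase hu0 hu ht hw hlin hnu
    have h1 : Filter.Tendsto (fun n => (-(2 * Real.pi * k * ((s / √(a n) : ℝ) : ℂ)) / L : ℂ))
        Filter.atTop (nhds 0) := by
      have h := ((((Complex.continuous_ofReal.tendsto _).comp ht).const_mul
        (2 * Real.pi * k : ℂ)).neg).div_const (L : ℂ)
      simpa using h
    have h := h1.cexp.mul hphase.cexp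
    simp only [Complex.exp_zero, one_mul] at h
    simp only [hψ']
    convert h using 2
    push_cast
    rfl
  simp only [hA]
  exact tendsto_sqrt_div_pi_mul_integral hatop (by positivity) (Real.exp_pos _).le hmeas hbound hlim
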